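/- arXiv:2211.07218 — 3 statements merged into one kernel-verified Lean document; each statement's English description precedes it below -/
import Mathlib

section
/- For every σ > 0, every q ∈ (0,1], and every natural number α ≥ 2, the Rényi divergence of order α from the sampled Gaussian mixture μ_q to μ0 satisfies D_α(μ_q ‖ μ0) = (1/(α−1)) · log( Σ_{k=0}^{α} C(α,k) (1 − q)^{α−k} q^k exp((k² − k)/(2σ²)) ), where D_α(μ ‖ ν) := (1/(α−1)) log ∫ (dμ/dν)^α dν. -/
open MeasureTheory ProbabilityTheory

/-- The Gaussian measure `N(m, σ²)` on `ℝ`. -/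
noncomputable def gaussMeasure (m σ : ℝ) : Measure ℝ :=
  gaussianReal m ⟨σ ^ 2, sq_nonneg σ⟩

/-- The sampled Gaussian mixture `μ_q = (1 - q) · N(0, σ²) + q · N(1, σ²)`. -/
noncomputable def sgMixture (σ q : ℝ) : Measure ℝ :=
  ENNReal.ofReal (1 - q) • gaussMeasure 0 σ + ENNReal.ofReal q • gaussMeasure 1 σ

/-- The Rényi divergence of order `α` between two measures,
`D_α(μ ‖ ν) = (1/(α-1)) log ∫ (dμ/dν)^α dν`. -/
noncomputable def renyiDiv {X : Type*} [MeasurableSpace X] (α : ℝ) (μ ν : Measure X) : ℝ :=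
  (1 / (α - 1)) * Real.log (∫ x, (μ.rnDeriv ν x).toReal ^ α ∂ν)

lemma gaussMeasure_eq (m σ : ℝ) :
    gaussMeasure m σ = gaussianReal m (NNReal.mk (σ ^ 2) (sq_nonneg σ)) := rfl

lemma gauss_one_eq (σ : ℝ) (hσ : 0 < σ) : gaussMeasure 1 σ =
    (gaussMeasure 0 σ).withDensity
      (fun x => ENNReal.ofReal (Real.exp (x / σ ^ 2 - 1 / (2 * σ ^ 2)))) := by
  have hv : NNReal.mk (σ ^ 2) (sq_nonneg σ) ≠ 0 := by
    intro h
    have := congrArg NNReal.toReal h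
    rw [NNReal.coe_mk] at this
    exact (pow_pos hσ 2).ne' this
  simp only [gaussMeasure_eq]
  rw [gaussianReal_of_var_ne_zero _ hv, gaussianReal_of_var_ne_zero _ hv,
    ← withDensity_mul _ (measurable_gaussianPDF _ _) (by fun_prop)]
  congr 1
  ext x
  simp only [Pi.mul_apply, gaussianPDF]
  rw [← ENNReal.ofReal_mul (gaussianPDFReal_nonneg _ _ _)]
  congr 1
  simp only [gaussianPDFReal, NNReal.coe_mk]
  rw [mul_assoc _ (Real.exp _) (Real.exp _), ← Real.exp_add]
  congr 2
  field_simp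
  ring

lemma mixture_eq (σ q : ℝ) (hσ : 0 < σ) (hq0 : 0 < q) (hq1 : q ≤ 1) : sgMixture σ q =
    (gaussMeasure 0 σ).withDensity
      (fun x => ENNReal.ofReal
        ((1 - q) + q * Real.exp (x / σ ^ 2 - 1 / (2 * σ ^ 2)))) := by
  unfold sgMixture
  rw [gauss_one_eq σ hσ, ← withDensity_smul _ (by fun_prop), ← withDensity_const,
    ← withDensity_add_left (by fun_prop)]
  congr 1
  ext x
  simp only [Pi.add_apply, Pi.smul_apply, smul_eq_mul]
  rw [← ENNReal.ofReal_mul hq0.le, ← ENNReal.ofReal_add (by linarith) (by positivity)]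

lemma exp_pow_eq (σ : ℝ) (k : ℕ) (x : ℝ) :
    Real.exp (x / σ ^ 2 - 1 / (2 * σ ^ 2)) ^ k
      = Real.exp (-(k / (2 * σ ^ 2))) * Real.exp ((k / σ ^ 2) * x) := by
  rw [← Real.exp_nat_mul, ← Real.exp_add]
  congr 1
  ring

lemma integrable_pow (σ : ℝ) (k : ℕ) :
    Integrable (fun x => Real.exp (x / σ ^ 2 - 1 / (2 * σ ^ 2)) ^ k) (gaussMeasure 0 σ) := by
  simp_rw [exp_pow_eq]
  exact (integrable_exp_mul_gaussianReal _).const_mul _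

lemma integral_pow_eq (σ : ℝ) (hσ : 0 < σ) (k : ℕ) :
    ∫ x, Real.exp (x / σ ^ 2 - 1 / (2 * σ ^ 2)) ^ k ∂(gaussMeasure 0 σ)
      = Real.exp (((k : ℝ) ^ 2 - (k : ℝ)) / (2 * σ ^ 2)) := by
  simp_rw [exp_pow_eq]
  rw [integral_const_mul]
  have h := congrFun (mgf_fun_id_gaussianReal (μ := 0) (v := NNReal.mk (σ ^ 2) (sq_nonneg σ))) (k / σ ^ 2)
  simp only [mgf] at h
  simp only [gaussMeasure_eq]
  rw [h, ← Real.exp_add, NNReal.coe_mk]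
  congr 1
  field_simp
  ring

/-- For every `σ > 0`, `q ∈ (0,1]` and natural number `α ≥ 2`, the Rényi divergence of
order `α` from the sampled Gaussian mixture `μ_q` to `μ₀ = N(0, σ²)` equals
`(1/(α-1)) log (∑_{k=0}^{α} C(α,k) (1-q)^{α-k} q^k exp ((k²-k)/(2σ²)))`. -/
theorem renyiDiv_sgMixture_eq (σ : ℝ) (hσ : 0 < σ)
    (q : ℝ) (hq0 : 0 < q) (hq1 : q ≤ 1) (α : ℕ) (hα : 2 ≤ α) :
    renyiDiv (α : ℝ) (sgMixture σ q) (gaussMeasure 0 σ)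
      = (1 / ((α : ℝ) - 1)) * Real.log (∑ k ∈ Finset.range (α + 1),
          (α.choose k : ℝ) * (1 - q) ^ (α - k) * q ^ k
            * Real.exp (((k : ℝ) ^ 2 - (k : ℝ)) / (2 * σ ^ 2))) := by
  have hint : ∫ x, ((sgMixture σ q).rnDeriv (gaussMeasure 0 σ) x).toReal ^ (α : ℝ)
      ∂(gaussMeasure 0 σ) = ∑ k ∈ Finset.range (α + 1),
          (α.choose k : ℝ) * (1 - q) ^ (α - k) * q ^ k
            * Real.exp (((k : ℝ) ^ 2 - (k : ℝ)) / (2 * σ ^ 2)) := by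
    have : IsProbabilityMeasure (gaussMeasure 0 σ) := by
      rw [gaussMeasure_eq]; infer_instance
    have hae : (fun x => ((sgMixture σ q).rnDeriv (gaussMeasure 0 σ) x).toReal ^ (α : ℝ))
        =ᵐ[gaussMeasure 0 σ] fun x => ∑ k ∈ Finset.range (α + 1),
          ((α.choose k : ℝ) * (1 - q) ^ (α - k) * q ^ k)
            * Real.exp (x / σ ^ 2 - 1 / (2 * σ ^ 2)) ^ k := by
      rw [mixture_eq σ q hσ hq0 hq1]
      filter_upwards [Measure.rnDeriv_withDensity (gaussMeasure 0 σ)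
        (f := fun x => ENNReal.ofReal
          ((1 - q) + q * Real.exp (x / σ ^ 2 - 1 / (2 * σ ^ 2)))) (by fun_prop)] with x hx
      have h1 : 0 ≤ 1 - q := by linarith
      rw [hx, ENNReal.toReal_ofReal (by positivity), Real.rpow_natCast, add_comm, add_pow]
      refine Finset.sum_congr rfl fun k _ => ?_
      rw [mul_pow]
      ring
    rw [integral_congr_ae hae, integral_finsetSum _ fun k _ => (integrable_pow σ k).const_mul _]
    refine Finset.sum_congr rfl fun k _ => ?_
    rw [integral_const_mul, integral_pow_eq σ hσ]
  unfold renyiDiv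
  rw [hint]
end

section
/- (Theorem 1 of the paper, instantiated on the sampled Gaussian mechanism distributions.) For every σ > 0, every sampling rate q ∈ (0,1], every natural number α ≥ 2, every natural number τ ≥ 1 (the number of accepted iterations), and every 0 < δ < 1, set ε := (τ/(α−1)) · Σ_{k=0}^{α} C(α,k) (1 − q)^{α−k} q^k exp((k² − k)/(2σ²)) + log(1/δ)/(α−1). Then for every measurable set S ⊆ ℝ^τ, μ_q^{⊗τ}(S) ≤ e^ε · μ0^{⊗τ}(S) + δ. -/
open MeasureTheory ProbabilityTheory

lemma aux_gm (m σ : ℝ) : gaussMeasure m σ = gaussianReal m (Real.toNNReal (σ ^ 2)) := by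
  have : (⟨σ ^ 2, sq_nonneg σ⟩ : NNReal) = Real.toNNReal (σ ^ 2) :=
    NNReal.eq (Real.coe_toNNReal _ (sq_nonneg σ)).symm
  exact congrArg (gaussianReal m) this

lemma aux_lintegral_pi {n : ℕ} (μ : Measure ℝ) [IsProbabilityMeasure μ]
    (f : Fin n → ℝ → ENNReal) (hf : ∀ i, Measurable (f i)) :
    ∫⁻ x, ∏ i, f i (x i) ∂(Measure.pi fun _ : Fin n => μ) = ∏ i, ∫⁻ x, f i x ∂μ := by
  rw [lintegral_prod_eq_prod_lintegral_of_indepFun Finset.univ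
    (fun i (x : Fin n → ℝ) => f i (x i))
    (iIndepFun_pi (fun i => (hf i).aemeasurable)) (fun i => (hf i).comp (measurable_pi_apply i))]
  refine Finset.prod_congr rfl fun i _ => ?_
  exact (measurePreserving_eval (fun _ : Fin n => μ) i).lintegral_comp (hf i)

lemma aux_pi_withDensity {n : ℕ} (μ ν : Measure ℝ) [IsProbabilityMeasure μ]
    [IsProbabilityMeasure ν] (f : ℝ → ENNReal) (hf : Measurable f) (hν : ν = μ.withDensity f) :
    (Measure.pi fun _ : Fin n => ν)
      = (Measure.pi fun _ : Fin n => μ).withDensity (fun x => ∏ i, f (x i)) := by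
  refine Measure.pi_eq fun s hs => ?_
  rw [withDensity_apply _ (MeasurableSet.univ_pi hs), ← lintegral_indicator
    (MeasurableSet.univ_pi hs)]
  have : ∀ x : Fin n → ℝ, (Set.univ.pi s).indicator (fun x : Fin n → ℝ => ∏ i, f (x i)) x
      = ∏ i, (s i).indicator f (x i) := by
    intro x
    by_cases hx : x ∈ Set.univ.pi s
    · rw [Set.indicator_of_mem hx]
      refine Finset.prod_congr rfl fun i _ => ?_
      rw [Set.indicator_of_mem (hx i (Set.mem_univ i))]
    · rw [Set.indicator_of_notMem hx]
      simp only [Set.mem_pi, Set.mem_univ, true_imp_iff, not_forall] at hx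
      obtain ⟨i, hi⟩ := hx
      exact (Finset.prod_eq_zero (Finset.mem_univ i) (Set.indicator_of_notMem hi _)).symm
  simp_rw [this]
  rw [aux_lintegral_pi μ (fun i => (s i).indicator f) (fun i => hf.indicator (hs i))]
  refine Finset.prod_congr rfl fun i _ => ?_
  rw [lintegral_indicator (hs i), hν, withDensity_apply _ (hs i)]

lemma aux_pointwise (F c : ENNReal) (hc0 : c ≠ 0) (hc : c ≠ ⊤) (n : ℕ) :
    F ≤ c + F ^ (n + 1) / c ^ n := by
  rcases le_total F c with h | h
  · exact h.trans le_self_add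
  · refine le_trans ?_ le_add_self
    rw [ENNReal.le_div_iff_mul_le (Or.inl (pow_ne_zero _ hc0))
      (Or.inl (ENNReal.pow_ne_top hc)), pow_succ, mul_comm]
    gcongr

noncomputable def auxL (σ q x : ℝ) : ℝ := (1 - q) + q * Real.exp ((2 * x - 1) / (2 * σ ^ 2))

lemma aux_density (σ : ℝ) (hσ : 0 < σ) (q : ℝ) (hq0 : 0 < q) (hq1 : q ≤ 1) :
    sgMixture σ q = (gaussMeasure 0 σ).withDensity (fun x => ENNReal.ofReal (auxL σ q x)) := by
  have hv : Real.toNNReal (σ ^ 2) ≠ 0 := by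
    have := pow_pos hσ 2
    simpa using hσ.ne'
  have h1 : gaussMeasure 1 σ = (gaussMeasure 0 σ).withDensity
      (fun x => ENNReal.ofReal (Real.exp ((2 * x - 1) / (2 * σ ^ 2)))) := by
    rw [aux_gm, aux_gm, gaussianReal_of_var_ne_zero _ hv, gaussianReal_of_var_ne_zero _ hv,
      ← withDensity_mul _ (measurable_gaussianPDF _ _) (by fun_prop)]
    congr 1
    ext x
    simp only [Pi.mul_apply, gaussianPDF]
    rw [← ENNReal.ofReal_mul (gaussianPDFReal_nonneg _ _ _)]
    congr 1
    simp only [gaussianPDFReal, Real.coe_toNNReal _ (sq_nonneg σ)]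
    rw [mul_assoc _ (Real.exp _) (Real.exp _), ← Real.exp_add]
    congr 2
    field_simp
    ring
  unfold sgMixture
  rw [h1, ← withDensity_smul _ (by fun_prop)]
  have h2 : ENNReal.ofReal (1 - q) • gaussMeasure 0 σ
      = (gaussMeasure 0 σ).withDensity (fun _ => ENNReal.ofReal (1 - q)) := by
    rw [withDensity_const]
  rw [h2, ← withDensity_add_left (by fun_prop)]
  congr 1
  ext x
  simp only [Pi.add_apply, Pi.smul_apply, smul_eq_mul, auxL]
  rw [← ENNReal.ofReal_mul hq0.le, ← ENNReal.ofReal_add (by linarith) (by positivity)]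

lemma aux_moment (σ : ℝ) (hσ : 0 < σ) (q : ℝ) (hq0 : 0 < q) (hq1 : q ≤ 1) (α : ℕ) :
    ∫⁻ x, ENNReal.ofReal (auxL σ q x) ^ α ∂(gaussMeasure 0 σ) = ENNReal.ofReal
      (∑ k ∈ Finset.range (α + 1), (α.choose k : ℝ) * (1 - q) ^ (α - k) * q ^ k
              * Real.exp (((k : ℝ) ^ 2 - (k : ℝ)) / (2 * σ ^ 2))) := by
  have hL : ∀ x, 0 ≤ auxL σ q x := fun x => by
    unfold auxL
    have : 0 ≤ 1 - q := by linarith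
    positivity
  have hexp : ∀ x, auxL σ q x ^ α = ∑ k ∈ Finset.range (α + 1),
      ((α.choose k : ℝ) * (1 - q) ^ (α - k) * q ^ k * Real.exp (-(k : ℝ) / (2 * σ ^ 2)))
        * Real.exp ((k : ℝ) / σ ^ 2 * x) := by
    intro x
    unfold auxL
    rw [add_comm, add_pow]
    refine Finset.sum_congr rfl fun k _ => ?_
    rw [mul_pow, ← Real.exp_nat_mul, mul_assoc _ (Real.exp _) (Real.exp _), ← Real.exp_add]
    have : (k : ℝ) * ((2 * x - 1) / (2 * σ ^ 2))
      = -(k : ℝ) / (2 * σ ^ 2) + (k : ℝ) / σ ^ 2 * x := by field_simp; ring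
    rw [this]; ring
  have hint : ∀ k ∈ Finset.range (α + 1), Integrable (fun x =>
      ((α.choose k : ℝ) * (1 - q) ^ (α - k) * q ^ k * Real.exp (-(k : ℝ) / (2 * σ ^ 2)))
        * Real.exp ((k : ℝ) / σ ^ 2 * x)) (gaussMeasure 0 σ) := fun k _ =>
    by rw [aux_gm]; exact (integrable_exp_mul_gaussianReal _).const_mul _
  simp_rw [← ENNReal.ofReal_pow (hL _)]
  rw [← ofReal_integral_eq_lintegral_ofReal]
  · congr 1
    simp_rw [hexp]
    rw [integral_finsetSum _ hint]
    refine Finset.sum_congr rfl fun k _ => ?_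
    rw [integral_const_mul]
    have := congrFun (mgf_id_gaussianReal (μ := 0) (v := Real.toNNReal (σ ^ 2))) ((k : ℝ) / σ ^ 2)
    simp only [mgf, id, Real.coe_toNNReal _ (sq_nonneg σ)] at this
    rw [aux_gm, this, mul_assoc, ← Real.exp_add]
    congr 2
    field_simp
    ring
  · simp_rw [hexp]
    exact integrable_finsetSum _ hint
  · exact Filter.Eventually.of_forall fun x => pow_nonneg (hL x) _

/-- Theorem 1 of the paper, instantiated on the sampled Gaussian mechanism distributions:
for every `σ > 0`, `q ∈ (0,1]`, natural numbers `α ≥ 2` and `τ ≥ 1`, and `0 < δ < 1`,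
setting `ε = (τ/(α-1)) ∑_{k=0}^{α} C(α,k) (1-q)^{α-k} q^k exp ((k²-k)/(2σ²))
+ log (1/δ) / (α-1)`, the hockey-stick `(ε,δ)`-DP inequality
`μ_q^{⊗τ}(S) ≤ e^ε μ₀^{⊗τ}(S) + δ` holds for every measurable `S ⊆ ℝ^τ`. -/
theorem sa_dpsgd_privacy_loss (σ : ℝ) (hσ : 0 < σ)
    (q : ℝ) (hq0 : 0 < q) (hq1 : q ≤ 1) (α : ℕ) (hα : 2 ≤ α) (τ : ℕ) (hτ : 1 ≤ τ)
    (δ : ℝ) (hδ0 : 0 < δ) (hδ1 : δ < 1) (ε : ℝ)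
    (hε : ε = ((τ : ℝ) / ((α : ℝ) - 1)) * (∑ k ∈ Finset.range (α + 1),
            (α.choose k : ℝ) * (1 - q) ^ (α - k) * q ^ k
              * Real.exp (((k : ℝ) ^ 2 - (k : ℝ)) / (2 * σ ^ 2)))
          + Real.log (1 / δ) / ((α : ℝ) - 1)) :
    ∀ S : Set (Fin τ → ℝ), MeasurableSet S →
      (Measure.pi fun _ : Fin τ => sgMixture σ q) S
        ≤ ENNReal.ofReal (Real.exp ε) * (Measure.pi fun _ : Fin τ => gaussMeasure 0 σ) S
          + ENNReal.ofReal δ := by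
  intro S hS
  have : IsProbabilityMeasure (gaussMeasure 0 σ) := by rw [aux_gm]; infer_instance
  have : IsProbabilityMeasure (gaussMeasure 1 σ) := by rw [aux_gm]; infer_instance
  have : IsProbabilityMeasure (sgMixture σ q) := by
    constructor
    simp only [sgMixture, Measure.add_apply, Measure.smul_apply, measure_univ, smul_eq_mul, mul_one]
    rw [← ENNReal.ofReal_add (by linarith) hq0.le]
    simp
  have hLm : Measurable (fun x => ENNReal.ofReal (auxL σ q x)) := by
    unfold auxL; fun_prop
  rw [aux_pi_withDensity (n := τ) _ _ _ hLm (aux_density σ hσ q hq0 hq1), withDensity_apply _ hS]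
  obtain ⟨n, rfl⟩ : ∃ n, α = n + 1 := ⟨α - 1, by omega⟩
  have hmom := aux_moment σ hσ q hq0 hq1 (n + 1)
  set A := ∑ k ∈ Finset.range (n + 1 + 1), ((n + 1).choose k : ℝ) * (1 - q) ^ (n + 1 - k) * q ^ k
              * Real.exp (((k : ℝ) ^ 2 - (k : ℝ)) / (2 * σ ^ 2)) with hA
  have hA0 : 0 ≤ A := Finset.sum_nonneg fun k _ => by
    have : 0 ≤ 1 - q := by linarith
    positivity
  have hn : (0 : ℝ) < n := by
    have : 0 < n := by omega
    exact_mod_cast this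
  set c := ENNReal.ofReal (Real.exp ε) with hc
  have hc0 : c ≠ 0 := by simp [hc, Real.exp_pos]
  have hct : c ≠ ⊤ := ENNReal.ofReal_ne_top
  have hmain : (∫⁻ x, (∏ i : Fin τ, ENNReal.ofReal (auxL σ q (x i))) ^ (n + 1)
      ∂(Measure.pi fun _ : Fin τ => gaussMeasure 0 σ)) = ENNReal.ofReal A ^ τ := by
    simp_rw [← Finset.prod_pow]
    rw [aux_lintegral_pi _ (fun _ x => ENNReal.ofReal (auxL σ q x) ^ (n + 1))
      (fun _ => hLm.pow_const _)]
    simp [hmom]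
  calc _ ≤ ∫⁻ x in S, (c + (∏ i : Fin τ, ENNReal.ofReal (auxL σ q (x i))) ^ (n + 1) / c ^ n)
        ∂(Measure.pi fun _ : Fin τ => gaussMeasure 0 σ) :=
        lintegral_mono fun x => aux_pointwise _ c hc0 hct n
    _ = c * (Measure.pi fun _ : Fin τ => gaussMeasure 0 σ) S
        + ∫⁻ x in S, (∏ i : Fin τ, ENNReal.ofReal (auxL σ q (x i))) ^ (n + 1) / c ^ n
        ∂(Measure.pi fun _ : Fin τ => gaussMeasure 0 σ) := by
        rw [lintegral_add_left measurable_const, setLIntegral_const]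
    _ ≤ _ := by
        gcongr
        refine (setLIntegral_le_lintegral _ _).trans ?_
        simp_rw [div_eq_mul_inv]
        rw [lintegral_mul_const' _ _ (by simp [hc0, hct]), hmain, ← div_eq_mul_inv]
        refine ENNReal.div_le_of_le_mul ?_
        rw [hc, ← ENNReal.ofReal_pow hA0, ← ENNReal.ofReal_pow (Real.exp_pos _).le,
          ← ENNReal.ofReal_mul hδ0.le]
        refine ENNReal.ofReal_le_ofReal ?_
        have h3 : (n : ℝ) * ε = τ * A + -Real.log δ := by
          rw [hε]
          push_cast
          rw [one_div, Real.log_inv]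
          rw [add_sub_cancel_right]
          field_simp
        rw [← Real.exp_nat_mul, h3, Real.exp_add, Real.exp_neg, Real.exp_log hδ0, Real.exp_nat_mul]
        have h4 : A ^ τ ≤ Real.exp A ^ τ := by
          gcongr
          linarith [Real.add_one_le_exp A]
        calc A ^ τ ≤ Real.exp A ^ τ := h4
          _ = _ := by field_simp
end

section
/- (Symmetric direction of Theorem 1 of the paper, instantiated on the sampled Gaussian mechanism distributions.) For every σ > 0, every sampling rate q ∈ (0,1], every natural number α ≥ 2, every natural number τ ≥ 1, and every 0 < δ < 1, set ε := (τ/(α−1)) · Σ_{k=0}^{α} C(α,k) (1 − q)^{α−k} q^k exp((k² − k)/(2σ²)) + log(1/δ)/(α−1). Then for every measurable set S ⊆ ℝ^τ, μ0^{⊗τ}(S) ≤ e^ε · μ_q^{⊗τ}(S) + δ. -/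
open MeasureTheory ProbabilityTheory

noncomputable def sgF (n : ℕ) (x : ℝ) : ℝ := 1 + ∑ j ∈ Finset.range n, (x ^ (j+1) + x⁻¹ ^ (j+1))

lemma sgF_eq (n : ℕ) (x : ℝ) (hx : 0 < x) : x ^ (n+1) - x⁻¹ ^ n = (x - 1) * sgF n x := by
  induction n with
  | zero => simp [sgF]
  | succ n ih =>
    have h : sgF (n+1) x = sgF n x + (x ^ (n+1) + x⁻¹ ^ (n+1)) := by
      simp only [sgF, Finset.sum_range_succ]; ring
    rw [h, mul_add, ← ih]
    have h2 : x⁻¹ ^ n = x * x⁻¹ ^ (n+1) := by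
      rw [pow_succ]; field_simp
    rw [h2]; ring

lemma add_inv_mono (y z : ℝ) (hy : 1 ≤ y) (hz : y ≤ z) : y + y⁻¹ ≤ z + z⁻¹ := by
  have hy0 : 0 < y := by linarith
  have hz0 : 0 < z := by linarith
  have : z + z⁻¹ - (y + y⁻¹) = (z - y) * (y * z - 1) / (y * z) := by
    field_simp; ring
  have : 0 ≤ (z - y) * (y * z - 1) / (y * z) := by
    apply div_nonneg _ (by positivity)
    apply mul_nonneg <;> nlinarith
  linarith

lemma sgF_mono (n : ℕ) (a b : ℝ) (hb : 0 < b) (hb1 : b ≤ 1) (hab : b⁻¹ ≤ a) :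
    sgF n b ≤ sgF n a := by
  unfold sgF
  refine add_le_add_right (Finset.sum_le_sum fun j _ => ?_) 1
  have h1 : 1 ≤ b⁻¹ := (one_le_inv₀ hb).2 hb1
  have := add_inv_mono (b⁻¹ ^ (j+1)) (a ^ (j+1)) (one_le_pow₀ h1)
    (pow_le_pow_left₀ (by positivity) hab _)
  simp only [inv_pow, inv_inv] at this ⊢
  linarith

lemma key_ge (n : ℕ) (q g : ℝ) (hq0 : 0 < q) (hq1 : q ≤ 1) (hg : 1 ≤ g) :
    (1 - q + q * g)⁻¹ ^ n + g * (1 - q + q * g⁻¹)⁻¹ ^ n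
      ≤ (1 - q + q * g) ^ (n+1) + g * (1 - q + q * g⁻¹) ^ (n+1) := by
  have hg0 : 0 < g := by linarith
  have hgi : 0 < g⁻¹ := by positivity
  have hgi1 : g⁻¹ ≤ 1 := inv_le_one_of_one_le₀ hg
  have ha : 0 < 1 - q + q * g := by nlinarith [mul_pos hq0 hg0]
  have hb : 0 < 1 - q + q * g⁻¹ := by nlinarith [mul_pos hq0 hgi]
  have e1 := sgF_eq n _ ha
  have e2 := sgF_eq n _ hb
  have hm : sgF n (1 - q + q * g⁻¹) ≤ sgF n (1 - q + q * g) := by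
    apply sgF_mono n _ _ hb (by nlinarith)
    rw [inv_le_iff_one_le_mul₀ hb]
    have h2 : g * g⁻¹ = 1 := mul_inv_cancel₀ hg0.ne'
    have h3 := add_inv_mono 1 g le_rfl hg
    have : (1 - q + q * g) * (1 - q + q * g⁻¹) = (1-q)^2 + q^2 * (g * g⁻¹) + q*(1-q)*(g+g⁻¹) := by ring
    rw [this, h2]
    nlinarith [mul_nonneg hq0.le (sub_nonneg.2 hq1)]
  have h2 : g * (1 - q + q * g⁻¹ - 1) = - (q * (g - 1)) := by field_simp; ring
  have h3 : g * ((1 - q + q * g⁻¹) ^ (n+1) - (1 - q + q * g⁻¹)⁻¹ ^ n)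
     = - (q * (g - 1)) * sgF n (1 - q + q * g⁻¹) := by rw [e2, ← mul_assoc, h2]
  have h4 : 0 ≤ (q * (g-1)) * (sgF n (1 - q + q * g) - sgF n (1 - q + q * g⁻¹)) := by
    apply mul_nonneg (mul_nonneg hq0.le (by linarith)) (by linarith)
  nlinarith

lemma key_all (n : ℕ) (q g : ℝ) (hq0 : 0 < q) (hq1 : q ≤ 1) (hg : 0 < g) :
    (1 - q + q * g)⁻¹ ^ n + g * (1 - q + q * g⁻¹)⁻¹ ^ n
      ≤ (1 - q + q * g) ^ (n+1) + g * (1 - q + q * g⁻¹) ^ (n+1) := by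
  rcases le_total 1 g with h | h
  · exact key_ge n q g hq0 hq1 h
  · have := mul_le_mul_of_nonneg_left (key_ge n q g⁻¹ hq0 hq1 ((one_le_inv₀ hg).2 h)) hg.le
    rw [inv_inv, mul_add, mul_add, ← mul_assoc, ← mul_assoc, mul_inv_cancel₀ hg.ne'] at this
    linarith

noncomputable def sgG (σ x : ℝ) : ℝ := Real.exp ((2 * x - 1) / (2 * σ ^ 2))
noncomputable def sgR (σ q x : ℝ) : ℝ := 1 - q + q * sgG σ x

lemma sgG_pos (σ x : ℝ) : 0 < sgG σ x := Real.exp_pos _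
lemma sgG_meas (σ : ℝ) : Measurable (sgG σ) := by unfold sgG; fun_prop
lemma sgR_meas (σ q : ℝ) : Measurable (sgR σ q) := by
  have := sgG_meas σ
  unfold sgR; fun_prop
lemma sgR_pos (σ q x : ℝ) (hq0 : 0 < q) (hq1 : q ≤ 1) : 0 < sgR σ q x := by
  have := mul_pos hq0 (sgG_pos σ x)
  unfold sgR; linarith
lemma sgG_refl (σ x : ℝ) : sgG σ (1 - x) = (sgG σ x)⁻¹ := by
  unfold sgG; rw [← Real.exp_neg]; congr 1; ring

noncomputable def sgV (σ : ℝ) : NNReal := Real.toNNReal (σ ^ 2)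

lemma sgV_coe (σ : ℝ) : ((sgV σ : NNReal) : ℝ) = σ ^ 2 := Real.coe_toNNReal _ (sq_nonneg σ)

lemma gm_eq (m σ : ℝ) : gaussMeasure m σ = gaussianReal m (sgV σ) := by
  have h : (show NNReal from ⟨σ ^ 2, sq_nonneg σ⟩) = sgV σ := NNReal.eq (sgV_coe σ).symm
  exact congrArg (gaussianReal m) h

instance (m σ : ℝ) : IsProbabilityMeasure (gaussMeasure m σ) := by
  rw [gm_eq]; infer_instance

lemma gauss_one (σ : ℝ) (hσ : 0 < σ) :
    gaussMeasure 1 σ = (gaussMeasure 0 σ).withDensity (fun x => ENNReal.ofReal (sgG σ x)) := by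
  have hv : sgV σ ≠ 0 := by
    intro h
    have := congrArg NNReal.toReal h
    rw [sgV_coe] at this
    exact (pow_pos hσ 2).ne' this
  simp only [gm_eq]
  rw [gaussianReal_of_var_ne_zero _ hv, gaussianReal_of_var_ne_zero _ hv,
    ← withDensity_mul _ (measurable_gaussianPDF _ _) (sgG_meas σ).ennreal_ofReal]
  congr 1
  funext x
  simp only [Pi.mul_apply, gaussianPDF]
  rw [← ENNReal.ofReal_mul (gaussianPDFReal_nonneg _ _ _)]
  congr 1
  simp only [gaussianPDFReal, sgG, sgV_coe]
  rw [mul_assoc _ (Real.exp _), ← Real.exp_add]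
  congr 2
  field_simp
  ring

lemma mix_eq (σ q : ℝ) (hσ : 0 < σ) (hq0 : 0 < q) (hq1 : q ≤ 1) :
    sgMixture σ q = (gaussMeasure 0 σ).withDensity (fun x => ENNReal.ofReal (sgR σ q x)) := by
  have h : (fun x => ENNReal.ofReal (sgR σ q x))
     = (fun _ => ENNReal.ofReal (1 - q)) + ENNReal.ofReal q • (fun x => ENNReal.ofReal (sgG σ x)) := by
    funext x
    simp only [sgR, Pi.add_apply, Pi.smul_apply, smul_eq_mul]
    rw [← ENNReal.ofReal_mul hq0.le, ← ENNReal.ofReal_add (by linarith) 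
      (mul_nonneg hq0.le (sgG_pos _ _).le)]
  rw [h, withDensity_add_left measurable_const, withDensity_const,
    withDensity_smul _ (sgG_meas σ).ennreal_ofReal, ← gauss_one σ hσ]
  rfl

lemma refl_int (σ : ℝ) (hσ : 0 < σ) (f : ℝ → ENNReal) (hf : Measurable f) :
    ∫⁻ x, f x ∂(gaussMeasure 0 σ)
      = ∫⁻ x, ENNReal.ofReal (sgG σ x) * f (1 - x) ∂(gaussMeasure 0 σ) := by
  have h0 : gaussMeasure 0 σ = (gaussMeasure 1 σ).map (fun x => 1 - x) := by
    simp only [gm_eq]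
    rw [gaussianReal_map_const_sub]; simp
  conv_lhs => rw [h0]
  rw [lintegral_map hf (by fun_prop), gauss_one σ hσ,
    lintegral_withDensity_eq_lintegral_mul _ (sgG_meas σ).ennreal_ofReal (by fun_prop)]
  rfl

lemma B_le_A (σ q : ℝ) (hσ : 0 < σ) (hq0 : 0 < q) (hq1 : q ≤ 1) (n : ℕ) :
    ∫⁻ x, ENNReal.ofReal ((sgR σ q x)⁻¹ ^ n) ∂(gaussMeasure 0 σ)
      ≤ ∫⁻ x, ENNReal.ofReal ((sgR σ q x) ^ (n+1)) ∂(gaussMeasure 0 σ) := by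
  have hR := sgR_meas σ q
  have hG := sgG_meas σ
  have hp := fun x => sgR_pos σ q x hq0 hq1
  have hR2 : ∀ x, sgR σ q (1 - x) = 1 - q + q * (sgG σ x)⁻¹ := fun x => by
    rw [sgR, sgG_refl]
  have h1 : ∫⁻ x, ENNReal.ofReal ((sgR σ q x)⁻¹ ^ n) ∂(gaussMeasure 0 σ) +
      ∫⁻ x, ENNReal.ofReal ((sgR σ q x)⁻¹ ^ n) ∂(gaussMeasure 0 σ)
      ≤ ∫⁻ x, ENNReal.ofReal ((sgR σ q x) ^ (n+1)) ∂(gaussMeasure 0 σ) +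
      ∫⁻ x, ENNReal.ofReal ((sgR σ q x) ^ (n+1)) ∂(gaussMeasure 0 σ) := by
    nth_rw 2 [refl_int σ hσ _ (by fun_prop)]
    nth_rw 4 [refl_int σ hσ _ (by fun_prop)]
    rw [← lintegral_add_left (by fun_prop), ← lintegral_add_left (by fun_prop)]
    apply lintegral_mono
    intro x
    have a1 := (hp x).le
    have a2 := (hp (1-x)).le
    have a3 := (sgG_pos σ x).le
    simp only
    rw [← ENNReal.ofReal_mul a3, ← ENNReal.ofReal_mul a3,
      ← ENNReal.ofReal_add (by positivity) (by positivity),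
      ← ENNReal.ofReal_add (by positivity) (by positivity)]
    apply ENNReal.ofReal_le_ofReal
    rw [hR2]
    exact key_all n q _ hq0 hq1 (sgG_pos σ x)
  by_contra hc
  push Not at hc
  exact absurd h1 (not_le.2 (ENNReal.add_lt_add hc hc))

lemma A_eq (σ q : ℝ) (hσ : 0 < σ) (hq0 : 0 < q) (hq1 : q ≤ 1) (α : ℕ) :
    ∫⁻ x, ENNReal.ofReal ((sgR σ q x) ^ α) ∂(gaussMeasure 0 σ)
      = ENNReal.ofReal (∑ k ∈ Finset.range (α + 1),
            (α.choose k : ℝ) * (1 - q) ^ (α - k) * q ^ k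
              * Real.exp (((k : ℝ) ^ 2 - (k : ℝ)) / (2 * σ ^ 2))) := by
  have hexp : ∀ x, sgR σ q x ^ α = ∑ k ∈ Finset.range (α + 1),
      ((α.choose k : ℝ) * (1 - q) ^ (α - k) * q ^ k * Real.exp (-(k : ℝ) / (2 * σ^2)))
        * Real.exp ((k / σ^2) * x) := by
    intro x
    rw [sgR, add_comm, add_pow]
    refine Finset.sum_congr rfl fun k _ => ?_
    rw [mul_assoc _ (Real.exp _), ← Real.exp_add, mul_pow, sgG, ← Real.exp_nat_mul]
    have : (k : ℝ) * ((2 * x - 1) / (2 * σ ^ 2)) = -(k : ℝ) / (2 * σ^2) + (k / σ^2) * x := by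
      field_simp; ring
    rw [this]; ring
  have hint : ∀ k : ℕ, Integrable (fun x => ((α.choose k : ℝ) * (1 - q) ^ (α - k) * q ^ k * Real.exp (-(k : ℝ) / (2 * σ^2)))
        * Real.exp ((k / σ^2) * x)) (gaussMeasure 0 σ) := fun k =>
    by
    rw [gm_eq]; exact (integrable_exp_mul_gaussianReal _).const_mul _
  rw [← ofReal_integral_eq_lintegral_ofReal]
  · congr 1
    simp_rw [hexp]
    rw [integral_finsetSum _ fun k _ => hint k]
    refine Finset.sum_congr rfl fun k _ => ?_
    rw [integral_const_mul]
    have := congrFun (mgf_id_gaussianReal (μ := 0) (v := sgV σ)) (k / σ^2)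
    simp only [mgf, id] at this
    simp only [gm_eq]
    rw [this, mul_assoc _ (Real.exp _), ← Real.exp_add]
    congr 2
    simp only [sgV_coe]
    field_simp
    ring
  · simp_rw [hexp]
    exact integrable_finsetSum _ fun k _ => hint k
  · exact ae_of_all _ fun x => pow_nonneg (sgR_pos σ q x hq0 hq1).le _

lemma lint_prod {τ : ℕ} (μ : Measure ℝ) [IsProbabilityMeasure μ] (f : Fin τ → ℝ → ENNReal)
    (hf : ∀ i, Measurable (f i)) :
    ∫⁻ x, ∏ i, f i (x i) ∂(Measure.pi fun _ : Fin τ => μ) = ∏ i, ∫⁻ x, f i x ∂μ := by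
  have hi : iIndepFun (fun i (x : Fin τ → ℝ) => f i (x i)) (Measure.pi fun _ : Fin τ => μ) :=
    iIndepFun_pi fun i => (hf i).aemeasurable
  rw [lintegral_prod_eq_prod_lintegral_of_indepFun Finset.univ _ hi (fun i => by fun_prop)]
  refine Finset.prod_congr rfl fun i _ => ?_
  exact (measurePreserving_eval (fun _ : Fin τ => μ) i).lintegral_comp (hf i)

lemma pi_density {τ : ℕ} (μ : Measure ℝ) [IsProbabilityMeasure μ] (f : ℝ → ENNReal)
    (hf : Measurable f) [SigmaFinite (μ.withDensity f)] :
    (Measure.pi fun _ : Fin τ => μ.withDensity f)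
      = (Measure.pi fun _ : Fin τ => μ).withDensity (fun x => ∏ i, f (x i)) := by
  refine Measure.pi_eq fun s hs => ?_
  rw [withDensity_apply _ (MeasurableSet.univ_pi hs), ← lintegral_indicator (MeasurableSet.univ_pi hs)]
  have : ∀ x : Fin τ → ℝ, (Set.univ.pi s).indicator (fun x => ∏ i, f (x i)) x
      = ∏ i, (s i).indicator f (x i) := by
    intro x
    by_cases h : x ∈ Set.univ.pi s
    · rw [Set.indicator_of_mem h]
      refine Finset.prod_congr rfl fun i _ => ?_
      rw [Set.indicator_of_mem (h i trivial)]
    · rw [Set.indicator_of_notMem h]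
      simp only [Set.mem_pi, Set.mem_univ, true_implies, not_forall] at h
      obtain ⟨i, hi⟩ := h
      exact (Finset.prod_eq_zero (Finset.mem_univ i) (Set.indicator_of_notMem hi _)).symm
  simp_rw [this]
  rw [lint_prod μ _ fun i => hf.indicator (hs i)]
  refine Finset.prod_congr rfl fun i _ => ?_
  rw [withDensity_apply _ (hs i), lintegral_indicator (hs i)]

/-- Symmetric direction of Theorem 1 of the paper, instantiated on the sampled Gaussian mechanism distributions:
for every `σ > 0`, `q ∈ (0,1]`, natural numbers `α ≥ 2` and `τ ≥ 1`, and `0 < δ < 1`,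
setting `ε = (τ/(α-1)) ∑_{k=0}^{α} C(α,k) (1-q)^{α-k} q^k exp ((k²-k)/(2σ²))
+ log (1/δ) / (α-1)`, the hockey-stick `(ε,δ)`-DP inequality
`μ₀^{⊗τ}(S) ≤ e^ε μ_q^{⊗τ}(S) + δ` holds for every measurable `S ⊆ ℝ^τ` (symmetric
direction, relying on the bound `B_α(q,σ) ≤ A_α(q,σ)`). -/
theorem sa_dpsgd_privacy_loss_symm (σ : ℝ) (hσ : 0 < σ)
    (q : ℝ) (hq0 : 0 < q) (hq1 : q ≤ 1) (α : ℕ) (hα : 2 ≤ α) (τ : ℕ) (hτ : 1 ≤ τ)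
    (δ : ℝ) (hδ0 : 0 < δ) (hδ1 : δ < 1) (ε : ℝ)
    (hε : ε = ((τ : ℝ) / ((α : ℝ) - 1)) * (∑ k ∈ Finset.range (α + 1),
            (α.choose k : ℝ) * (1 - q) ^ (α - k) * q ^ k
              * Real.exp (((k : ℝ) ^ 2 - (k : ℝ)) / (2 * σ ^ 2)))
          + Real.log (1 / δ) / ((α : ℝ) - 1)) :
    ∀ S : Set (Fin τ → ℝ), MeasurableSet S →
      (Measure.pi fun _ : Fin τ => gaussMeasure 0 σ) S
        ≤ ENNReal.ofReal (Real.exp ε) * (Measure.pi fun _ : Fin τ => sgMixture σ q) S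
          + ENNReal.ofReal δ := by
  intro S hS
  obtain ⟨n, rfl⟩ : ∃ n, α = n + 1 := ⟨α - 1, by omega⟩
  have hn : 0 < n := by omega
  have hnR : (0 : ℝ) < n := by exact_mod_cast hn
  set A : ℝ := ∑ k ∈ Finset.range (n + 1 + 1),
            ((n+1).choose k : ℝ) * (1 - q) ^ (n + 1 - k) * q ^ k
              * Real.exp (((k : ℝ) ^ 2 - (k : ℝ)) / (2 * σ ^ 2)) with hA
  have hA0 : 0 ≤ A := by
    refine Finset.sum_nonneg fun k _ => ?_
    have : 0 ≤ 1 - q := by linarith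
    positivity
  have hnε : n * ε = τ * A - Real.log δ := by
    rw [hε, one_div, Real.log_inv]
    push_cast
    rw [add_sub_cancel_right]
    field_simp
    ring
  have hδe : δ * Real.exp (n * ε) = Real.exp (τ * A) := by
    rw [hnε, Real.exp_sub, Real.exp_log hδ0]; field_simp
  have hR := sgR_meas σ q
  have hp := fun x => sgR_pos σ q x hq0 hq1
  have hfin : IsProbabilityMeasure (sgMixture σ q) := by
    constructor
    simp only [sgMixture, Measure.add_apply, Measure.smul_apply, measure_univ, smul_eq_mul, mul_one]
    rw [← ENNReal.ofReal_add (by linarith) hq0.le]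
    simp
  have hmix := mix_eq σ q hσ hq0 hq1
  rw [hmix] at hfin ⊢
  rw [pi_density _ _ hR.ennreal_ofReal, withDensity_apply _ hS]
  set P := (Measure.pi fun _ : Fin τ => gaussMeasure 0 σ) with hP
  set T : Set (Fin τ → ℝ) := {x | Real.exp ε * ∏ i, sgR σ q (x i) < 1} with hT
  have hRp : Measurable fun x : Fin τ → ℝ => ∏ i, sgR σ q (x i) := by fun_prop
  have hTm : MeasurableSet T := measurableSet_lt (by fun_prop) measurable_const
  rw [← measure_sdiff_add_inter S hTm]
  refine add_le_add ?_ ((measure_mono Set.inter_subset_right).trans ?_)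
  · rw [← setLIntegral_one, ← lintegral_const_mul _ (by fun_prop)]
    calc ∫⁻ x in S \ T, 1 ∂P ≤ ∫⁻ x in S \ T, ENNReal.ofReal (Real.exp ε) *
            ∏ i, ENNReal.ofReal (sgR σ q (x i)) ∂P := by
          refine setLIntegral_mono' (hS.diff hTm) fun x hx => ?_
          rw [← ENNReal.ofReal_prod_of_nonneg fun i _ => (hp _).le,
            ← ENNReal.ofReal_mul (Real.exp_pos _).le]
          have := hx.2
          simp only [hT, Set.mem_setOf_eq, not_lt] at this
          simpa using this
      _ ≤ _ := lintegral_mono_set Set.diff_subset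
  · have hW : Measurable fun x : Fin τ → ℝ => ∏ i, ENNReal.ofReal ((sgR σ q (x i))⁻¹ ^ n) := by
      fun_prop
    have hmk := mul_meas_ge_le_lintegral (μ := P) hW (ENNReal.ofReal (Real.exp (n * ε)))
    rw [hP, lint_prod (gaussMeasure 0 σ) (fun _ x => ENNReal.ofReal ((sgR σ q x)⁻¹ ^ n))
      (fun _ => by fun_prop), ← hP] at hmk
    have hsub : T ⊆ {x | ENNReal.ofReal (Real.exp (n * ε)) ≤
        ∏ i, ENNReal.ofReal ((sgR σ q (x i))⁻¹ ^ n)} := by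
      intro x hx
      have hpp : 0 < ∏ i, sgR σ q (x i) := Finset.prod_pos fun i _ => hp _
      simp only [hT, Set.mem_setOf_eq] at hx ⊢
      rw [← ENNReal.ofReal_prod_of_nonneg fun i _ => pow_nonneg (inv_nonneg.2 (hp _).le) _]
      apply ENNReal.ofReal_le_ofReal
      rw [Finset.prod_pow, Finset.prod_inv_distrib, Real.exp_nat_mul]
      refine pow_le_pow_left₀ (Real.exp_pos _).le ?_ _
      rw [le_inv_comm₀ (Real.exp_pos _) hpp, ← one_div, le_div_iff₀ (Real.exp_pos _)]
      linarith
    have hB := B_le_A σ q hσ hq0 hq1 n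
    rw [A_eq σ q hσ hq0 hq1 (n+1), ← hA] at hB
    have hpos : ENNReal.ofReal (Real.exp (n * ε)) ≠ 0 := by
      simpa using Real.exp_pos _
    have hfinal : ENNReal.ofReal (Real.exp (n * ε)) * P T
        ≤ ENNReal.ofReal (Real.exp (n * ε)) * ENNReal.ofReal δ := by
      calc _ ≤ _ := mul_le_mul_right (measure_mono hsub) _
        _ ≤ _ := hmk
        _ ≤ ENNReal.ofReal A ^ τ := by
          rw [Finset.prod_const, Finset.card_univ, Fintype.card_fin]
          exact pow_le_pow_left' hB _
        _ ≤ _ := by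
          rw [← ENNReal.ofReal_pow hA0, ← ENNReal.ofReal_mul (Real.exp_pos _).le,
            mul_comm, hδe, Real.exp_nat_mul]
          apply ENNReal.ofReal_le_ofReal
          refine pow_le_pow_left₀ hA0 ?_ _
          linarith [Real.add_one_le_exp A]
    exact (ENNReal.mul_le_mul_iff_right hpos ENNReal.ofReal_ne_top).1 hfinal
end
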